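/- There is an absolute constant C > 0 such that the following holds. Let f be a positive integer and let H be a graph on n vertices equipped with a linear order on its edges that admits a 6 double-blocking set of size at most f·|E(H)|. Then |E(H)| ≤ C·(n^{4/3} + n^{6/5}·f^{3/5} + f·n). -/

import Mathlib

open SimpleGraph
open scoped ENNReal

noncomputable section

/-- Weighted distance in a graph: the infimum, over all walks from `u` to `v`,
of the total weight of the walk's edges (`⊤` if there is no walk). -/
def wdist {V : Type} (G : SimpleGraph V) (w : Sym2 V → ℝ≥0∞) (u v : V) : ℝ≥0∞ :=
  ⨅ p : G.Walk u v, (p.edges.map w).sum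

/-- Distance in a graph `H` whose edge `(x, y)` is (re)weighted to `δ x y`. -/
def emulDist {V : Type} (H : SimpleGraph V) (δ : V → V → ℝ≥0∞) (u v : V) : ℝ≥0∞ :=
  ⨅ p : H.Walk u v, (p.darts.map (fun d => δ d.toProd.1 d.toProd.2)).sum

/-- `H` is an `f`-edge-fault-tolerant `t`-emulator of the weighted graph `(G, w)`:
for every fault set `F ⊆ E(G)` with `|F| ≤ f`, the graph `H` with every edge `(x,y)`
reweighted to `dist_{G∖F}(x,y)` approximates all distances of `G ∖ F` within factor `t`. -/
def IsEFTEmulator {V : Type} (G : SimpleGraph V) (w : Sym2 V → ℝ≥0∞)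
    (H : SimpleGraph V) (f : ℕ) (t : ℝ≥0∞) : Prop :=
  ∀ F : Finset (Sym2 V), ↑F ⊆ G.edgeSet → F.card ≤ f →
    ∀ u v : V,
      wdist (G.deleteEdges ↑F) w u v ≤ emulDist H (wdist (G.deleteEdges ↑F) w) u v ∧
      emulDist H (wdist (G.deleteEdges ↑F) w) u v ≤ t * wdist (G.deleteEdges ↑F) w u v

/-- `e` is the last edge of the list `l` in the order given by the ranking `π`. -/
def IsLastEdge {V : Type} (π : Sym2 V → ℕ) (l : List (Sym2 V)) (e : Sym2 V) : Prop :=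
  e ∈ l ∧ ∀ e' ∈ l, π e' ≤ π e

/-- The cycle `p` is blocked by the unordered pair `b` of edges: both members of `b`
lie on `p` and one of them is the last edge of `p` in the order `π`. -/
def CycleBlockedBy {V : Type} {H : SimpleGraph V} (π : Sym2 V → ℕ) {u : V}
    (p : H.Walk u u) (b : Sym2 (Sym2 V)) : Prop :=
  ∃ e1 e2 : Sym2 V, b = s(e1, e2) ∧ e1 ∈ p.edges ∧ e2 ∈ p.edges ∧ IsLastEdge π p.edges e1

/-- `B` is a `2k` double-blocking set for `H` with edge order `π`: it consists of
unordered pairs of distinct edges of `H`, every cycle with at most `2k` edges is blocked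
by a member of `B`, and every cycle with at most `k+1` edges is blocked by two
distinct members of `B`. -/
def IsDoubleBlockingSet {V : Type} (H : SimpleGraph V) (π : Sym2 V → ℕ) (k : ℕ)
    (B : Finset (Sym2 (Sym2 V))) : Prop :=
  (∀ b ∈ B, ¬ b.IsDiag ∧ ∀ e ∈ b, e ∈ H.edgeSet) ∧
  (∀ (u : V) (p : H.Walk u u), p.IsCycle → p.length ≤ 2 * k →
      ∃ b ∈ B, CycleBlockedBy π p b) ∧
  (∀ (u : V) (p : H.Walk u u), p.IsCycle → p.length ≤ k + 1 →
      ∃ b1 ∈ B, ∃ b2 ∈ B, b1 ≠ b2 ∧ CycleBlockedBy π p b1 ∧ CycleBlockedBy π p b2)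

/-- The number of pairs of `B` containing the edge `e`. -/
def edgeBlockCount {V : Type} (B : Finset (Sym2 (Sym2 V))) (e : Sym2 V) : ℕ :=
  {b ∈ (B : Set (Sym2 (Sym2 V))) | e ∈ b}.ncard

/-- The `i`-th edge of the vertex sequence `v`. -/
def edgeOf {V : Type} {k : ℕ} (v : Fin (k + 1) → V) (i : Fin k) : Sym2 V :=
  s(v i.castSucc, v i.succ)

/-- The average degree `2|E(H)|/n` of a graph on `n` vertices. -/
def avgDeg {V : Type} [Fintype V] (H : SimpleGraph V) : ℝ :=
  2 * (H.edgeSet.ncard : ℝ) / (Fintype.card V : ℝ)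

end
noncomputable section

/-- `v` is a SCUM `k`-path (for odd `k`), viewed as an oriented sequence of `k+1`
distinct pairwise-adjacent vertices: it is simple, its middle edge (the edge with
0-indexed position `(k-1)/2`, i.e. the index `j` with `2j+1 = k`) is the last edge
of the path in the order `π`, and the two oriented subpaths starting from the middle
edge and going towards either endpoint are chain-unblocked with respect to `B`. -/
def IsSCUM {V : Type} (H : SimpleGraph V) (π : Sym2 V → ℕ) (B : Finset (Sym2 (Sym2 V)))
    (k : ℕ) (v : Fin (k + 1) → V) : Prop :=
  Function.Injective v ∧
  (∀ i : Fin k, H.Adj (v i.castSucc) (v i.succ)) ∧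
  (∀ i j : Fin k, 2 * (j : ℕ) + 1 = k → π (edgeOf v i) ≤ π (edgeOf v j)) ∧
  (∀ (i : Fin k) (j : Fin (k + 1)), 2 * (i : ℕ) + 1 ≤ k → (j : ℕ) + 1 ≤ (i : ℕ) →
      ∀ e' : Sym2 V, s(edgeOf v i, e') ∈ B → v j ∉ e') ∧
  (∀ (i : Fin k) (j : Fin (k + 1)), k ≤ 2 * (i : ℕ) + 1 → (i : ℕ) + 2 ≤ (j : ℕ) →
      ∀ e' : Sym2 V, s(edgeOf v i, e') ∈ B → v j ∉ e')

/-- The number of (oriented) SCUM `k`-paths of `H`. -/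
def scumCount {V : Type} (H : SimpleGraph V) (π : Sym2 V → ℕ)
    (B : Finset (Sym2 (Sym2 V))) (k : ℕ) : ℕ :=
  {v : Fin (k + 1) → V | IsSCUM H π B k v}.ncard

/-- The number of (oriented, aligned) SCUM `k`-path meets of `H`: pairs of distinct
SCUM `k`-paths sharing both endpoints. -/
def scumMeetCount {V : Type} (H : SimpleGraph V) (π : Sym2 V → ℕ)
    (B : Finset (Sym2 (Sym2 V))) (k : ℕ) : ℕ :=
  {vv : (Fin (k + 1) → V) × (Fin (k + 1) → V) |
    IsSCUM H π B k vv.1 ∧ IsSCUM H π B k vv.2 ∧ vv.1 ≠ vv.2 ∧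
    vv.1 0 = vv.2 0 ∧ vv.1 (Fin.last k) = vv.2 (Fin.last k)}.ncard

/-- The oriented path given by the vertex sequence `a` is chain-unblocked with
respect to `B`: for any edge `e` of the path and any vertex `x` strictly following
`e` along the path, no pair `{e, e'} ∈ B` has `e'` incident on `x`. -/
def ChainUnblockedSeq {V : Type} (B : Finset (Sym2 (Sym2 V))) {L : ℕ}
    (a : Fin (L + 1) → V) : Prop :=
  ∀ (i : Fin L) (j : Fin (L + 1)), (i : ℕ) + 2 ≤ (j : ℕ) →
    ∀ e' : Sym2 V, s(edgeOf a i, e') ∈ B → a j ∉ e'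

/-- The walk `p` is blocked: some pair of `B` has both its edges on `p`. -/
def PathBlocked {V : Type} {H : SimpleGraph V} (B : Finset (Sym2 (Sym2 V)))
    {u v : V} (p : H.Walk u v) : Prop :=
  ∃ b ∈ B, ∀ e ∈ b, e ∈ p.edges

/-- The walk `p` is double-blocked: two distinct pairs of `B` have both their edges on `p`. -/
def PathDoubleBlocked {V : Type} {H : SimpleGraph V} (B : Finset (Sym2 (Sym2 V)))
    {u v : V} (p : H.Walk u v) : Prop :=
  ∃ b1 ∈ B, ∃ b2 ∈ B, b1 ≠ b2 ∧ (∀ e ∈ b1, e ∈ p.edges) ∧ (∀ e ∈ b2, e ∈ p.edges)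

/-- The subgraph of `H` consisting of the edge `e` together with all edges
preceding it in the order `π`. -/
def subEdges {V : Type} (H : SimpleGraph V) (π : Sym2 V → ℕ) (e : Sym2 V) : SimpleGraph V :=
  SimpleGraph.fromEdgeSet {e' ∈ H.edgeSet | π e' ≤ π e}

/-- `e` is a core edge of `H` (with respect to edge order `π` and degree threshold `d/4`):
`e` survives in the graph obtained from the subgraph of edges up to `e` by iteratively
deleting vertices of degree at most `d/4`; equivalently, there is a set `S` of vertices
containing both endpoints of `e` on which the subgraph of edges up to `e` induces
a graph of minimum degree greater than `d/4`. -/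
def IsCoreEdge {V : Type} (H : SimpleGraph V) (π : Sym2 V → ℕ) (d : ℝ) (e : Sym2 V) : Prop :=
  e ∈ H.edgeSet ∧
  ∃ S : Set V, (∀ x ∈ e, x ∈ S) ∧
    ∀ v ∈ S, d / 4 < ({u ∈ S | (subEdges H π e).Adj v u}.ncard : ℝ)

end

/-- The vertices lying on an edge that `B` pairs with `e`. -/
noncomputable def blockedVertices {V : Type} [Fintype V] (B : Finset (Sym2 (Sym2 V))) (e : Sym2 V) :
    Finset V := by
  classical
  exact Finset.univ.filter fun z => ∃ e', s(e, e') ∈ B ∧ z ∈ e'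

lemma mem_blockedVertices {V : Type} [Fintype V] {B : Finset (Sym2 (Sym2 V))} {e : Sym2 V}
    {z : V} : z ∈ blockedVertices B e ↔ ∃ e', s(e, e') ∈ B ∧ z ∈ e' := by
  simp [blockedVertices]

/-- A blocking pair of a cycle consists of the last edge of the cycle and another of its edges. -/
lemma CycleBlockedBy.exists_eq {V : Type} {H : SimpleGraph V} {π : Sym2 V → ℕ} {u : V}
    {p : H.Walk u u} {b : Sym2 (Sym2 V)} (h : CycleBlockedBy π p b)
    (hinj : Set.InjOn π H.edgeSet) (hb : ¬ b.IsDiag) {e₀ : Sym2 V} (he₀ : e₀ ∈ p.edges)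
    (hmax : ∀ e ∈ p.edges, π e ≤ π e₀) :
    ∃ e' ∈ p.edges, e' ≠ e₀ ∧ b = s(e₀, e') := by
  obtain ⟨e1, e2, rfl, h1, h2, -, h3⟩ := h
  have : e1 = e₀ := hinj (p.edges_subset_edgeSet h1) (p.edges_subset_edgeSet he₀)
    (le_antisymm (hmax _ h1) (h3 _ he₀))
  subst this
  refine ⟨e2, h2, ?_, rfl⟩
  rintro rfl
  exact hb (by simp)

/-- The apex of a triangle is blocked by its last edge. -/
lemma triangle_apex_mem_blockedVertices {V : Type} [Fintype V] {H : SimpleGraph V}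
    {π : Sym2 V → ℕ} {B : Finset (Sym2 (Sym2 V))} (hinj : Set.InjOn π H.edgeSet)
    (hB : IsDoubleBlockingSet H π 3 B) {a b c : V} (hab : H.Adj a b) (hbc : H.Adj b c)
    (hca : H.Adj c a) (h1 : π s(b, c) ≤ π s(a, b)) (h2 : π s(c, a) ≤ π s(a, b)) :
    c ∈ blockedVertices B s(a, b) := by
  have hcyc : (Walk.cons hab (Walk.cons hbc (Walk.cons hca Walk.nil))).IsCycle := by
    simp [Walk.cons_isCycle_iff, hab.ne, hbc.ne, hca.ne, hab.ne', hca.ne']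
  obtain ⟨b0, hb0, hbl⟩ := hB.2.1 _ _ hcyc (by simp)
  obtain ⟨e', he', hne, rfl⟩ := hbl.exists_eq hinj (hB.1 _ hb0).1 (e₀ := s(a, b))
    (by simp) (by simp [h1, h2])
  refine mem_blockedVertices.2 ⟨e', hb0, ?_⟩
  simp only [Walk.edges_cons, Walk.edges_nil, List.mem_cons, List.not_mem_nil, or_false] at he'
  rcases he' with rfl | rfl | rfl
  · exact absurd rfl hne
  · simp
  · simp

/-- In a 4-cycle, the last edge is paired with two further edges of the cycle. -/
lemma fourCycle_blocked {V : Type} {H : SimpleGraph V}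
    {π : Sym2 V → ℕ} {B : Finset (Sym2 (Sym2 V))} (hinj : Set.InjOn π H.edgeSet)
    (hB : IsDoubleBlockingSet H π 3 B) {a b c d : V} (hab : H.Adj a b) (hbc : H.Adj b c)
    (hcd : H.Adj c d) (hda : H.Adj d a) (hac : a ≠ c) (hbd : b ≠ d)
    (h1 : π s(b, c) ≤ π s(a, b)) (h2 : π s(c, d) ≤ π s(a, b)) (h3 : π s(d, a) ≤ π s(a, b)) :
    (s(s(a, b), s(b, c)) ∈ B ∧ s(s(a, b), s(c, d)) ∈ B) ∨
    (s(s(a, b), s(b, c)) ∈ B ∧ s(s(a, b), s(d, a)) ∈ B) ∨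
    (s(s(a, b), s(c, d)) ∈ B ∧ s(s(a, b), s(d, a)) ∈ B) := by
  have hcyc : (Walk.cons hab (Walk.cons hbc (Walk.cons hcd (Walk.cons hda Walk.nil)))).IsCycle := by
    simp [Walk.cons_isCycle_iff, hab.ne, hbc.ne, hcd.ne, hda.ne, hab.ne',
      hda.ne', hac, hac.symm, hbd]
  obtain ⟨b1, hb1, b2, hb2, hne, hbl1, hbl2⟩ := hB.2.2 _ _ hcyc (by simp)
  obtain ⟨e', he', hne', rfl⟩ := hbl1.exists_eq hinj (hB.1 _ hb1).1 (e₀ := s(a, b))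
    (by simp) (by simp [h1, h2, h3])
  obtain ⟨e'', he'', hne'', rfl⟩ := hbl2.exists_eq hinj (hB.1 _ hb2).1 (e₀ := s(a, b))
    (by simp) (by simp [h1, h2, h3])
  simp only [Walk.edges_cons, Walk.edges_nil, List.mem_cons, List.not_mem_nil, or_false] at he' he''
  rcases he' with rfl | rfl | rfl | rfl <;> rcases he'' with rfl | rfl | rfl | rfl <;>
    first
      | exact absurd rfl hne
      | exact absurd rfl hne'
      | exact absurd rfl hne''
      | tauto

/-- In a 6-cycle, the last edge is paired either with an edge through one of the two vertices
at distance one from it, or with the opposite edge. -/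
lemma sixCycle_blocked {V : Type} [Fintype V] {H : SimpleGraph V}
    {π : Sym2 V → ℕ} {B : Finset (Sym2 (Sym2 V))} (hinj : Set.InjOn π H.edgeSet)
    (hB : IsDoubleBlockingSet H π 3 B) {a b c d c' b' : V} (hab : H.Adj a b) (hbc : H.Adj b c)
    (hcd : H.Adj c d) (hdc : H.Adj d c') (hcb : H.Adj c' b') (hba : H.Adj b' a)
    (hnd : [a, b, c, d, c', b'].Nodup)
    (h1 : π s(a, b) ≤ π s(b, c)) (h2 : π s(c, d) ≤ π s(b, c)) (h3 : π s(d, c') ≤ π s(b, c))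
    (h4 : π s(c', b') ≤ π s(b, c)) (h5 : π s(b', a) ≤ π s(b, c))
    (ha : a ∉ blockedVertices B s(b, c)) (hd : d ∉ blockedVertices B s(b, c)) :
    s(s(b, c), s(c', b')) ∈ B := by
  simp only [List.nodup_cons, List.mem_cons, List.not_mem_nil, or_false, not_or] at hnd
  have hcyc : (Walk.cons hbc (Walk.cons hcd (Walk.cons hdc (Walk.cons hcb
      (Walk.cons hba (Walk.cons hab Walk.nil)))))).IsCycle := by
    simp only [Walk.cons_isCycle_iff, Walk.cons_isPath_iff, Walk.isPath_iff_nil,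
      Walk.support_cons, Walk.support_nil, Walk.edges_cons, Walk.edges_nil, List.mem_cons,
      List.not_mem_nil, or_false, not_or, Sym2.eq_iff]
    grind
  obtain ⟨b0, hb0, hbl⟩ := hB.2.1 _ _ hcyc (by simp)
  obtain ⟨e', he', hne, rfl⟩ := hbl.exists_eq hinj (hB.1 _ hb0).1 (e₀ := s(b, c))
    (by simp) (by simp [h1, h2, h3, h4, h5])
  have ha' : a ∉ e' := fun h => ha (mem_blockedVertices.2 ⟨e', hb0, h⟩)
  have hd' : d ∉ e' := fun h => hd (mem_blockedVertices.2 ⟨e', hb0, h⟩)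
  simp only [Walk.edges_cons, Walk.edges_nil, List.mem_cons, List.not_mem_nil, or_false] at he'
  rcases he' with rfl | rfl | rfl | rfl | rfl | rfl
  · exact absurd rfl hne
  · simp at hd'
  · simp at hd'
  · exact hb0
  · simp at ha'
  · simp at ha'

/-- Two common neighbours `x`, `y` of `u` and `w` block one another. -/
lemma commonNeighbors_blocked {V : Type} [Fintype V] {H : SimpleGraph V}
    {π : Sym2 V → ℕ} {B : Finset (Sym2 (Sym2 V))} (hinj : Set.InjOn π H.edgeSet)
    (hB : IsDoubleBlockingSet H π 3 B) {u w x y : V} (huw : u ≠ w) (hxy : x ≠ y)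
    (hux : H.Adj u x) (hwx : H.Adj w x) (huy : H.Adj u y) (hwy : H.Adj w y) :
    y ∈ blockedVertices B s(u, x) ∨ y ∈ blockedVertices B s(w, x) := by
  have key : (s(s(u, x), s(u, y)) ∈ B ∨ s(s(u, x), s(w, y)) ∈ B) ∨
      (s(s(w, x), s(u, y)) ∈ B ∨ s(s(w, x), s(w, y)) ∈ B) := by
    have sw (p q : Sym2 V) : s(p, q) = s(q, p) := Sym2.eq_swap
    have c1 := fourCycle_blocked hinj hB hux hwx.symm hwy huy.symm huw hxy
    have c2 := fourCycle_blocked hinj hB hwx hux.symm huy hwy.symm huw.symm hxy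
    have c3 := fourCycle_blocked hinj hB huy hwy.symm hwx hux.symm huw hxy.symm
    have c4 := fourCycle_blocked hinj hB hwy huy.symm hux hwx.symm huw.symm hxy.symm
    have e1 : s(x, w) = s(w, x) := Sym2.eq_swap
    have e2 : s(y, w) = s(w, y) := Sym2.eq_swap
    have e3 : s(x, u) = s(u, x) := Sym2.eq_swap
    have e4 : s(y, u) = s(u, y) := Sym2.eq_swap
    rw [e1, e4] at c1
    rw [e3, e2] at c2
    rw [e2, e3, sw s(u, y) s(w, x), sw s(u, y) s(u, x)] at c3
    rw [e4, e1, sw s(w, y) s(u, x), sw s(w, y) s(w, x)] at c4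
    have weak {p q r : Prop} : (p ∧ q) ∨ (p ∧ r) ∨ (q ∧ r) → q ∨ r := by tauto
    rcases le_total (π s(u, x)) (π s(w, x)) with g1 | g1 <;>
    rcases le_total (π s(u, y)) (π s(w, y)) with g2 | g2
    · rcases le_total (π s(w, x)) (π s(w, y)) with g3 | g3
      · rcases weak (c4 (by omega) (by omega) (by omega)) with h | h <;> simp [h]
      · rcases weak (c2 (by omega) (by omega) (by omega)) with h | h <;> simp [h]
    · rcases le_total (π s(w, x)) (π s(u, y)) with g3 | g3
      · rcases weak (c3 (by omega) (by omega) (by omega)) with h | h <;> simp [h]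
      · rcases weak (c2 (by omega) (by omega) (by omega)) with h | h <;> simp [h]
    · rcases le_total (π s(u, x)) (π s(w, y)) with g3 | g3
      · rcases weak (c4 (by omega) (by omega) (by omega)) with h | h <;> simp [h]
      · rcases weak (c1 (by omega) (by omega) (by omega)) with h | h <;> simp [h]
    · rcases le_total (π s(u, x)) (π s(u, y)) with g3 | g3
      · rcases weak (c3 (by omega) (by omega) (by omega)) with h | h <;> simp [h]
      · rcases weak (c1 (by omega) (by omega) (by omega)) with h | h <;> simp [h]
  simp only [mem_blockedVertices]
  rcases key with (h | h) | (h | h)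
  · exact Or.inl ⟨_, h, by simp⟩
  · exact Or.inl ⟨_, h, by simp⟩
  · exact Or.inr ⟨_, h, by simp⟩
  · exact Or.inr ⟨_, h, by simp⟩

/-- `H` restricted to the edges blocking at most `m` vertices. -/
def lightGraph {V : Type} [Fintype V] (H : SimpleGraph V) (B : Finset (Sym2 (Sym2 V))) (m : ℕ) :
    SimpleGraph V where
  Adj u v := H.Adj u v ∧ (blockedVertices B s(u, v)).card ≤ m
  symm := ⟨fun u v h => ⟨h.1.symm, by rw [Sym2.eq_swap]; exact h.2⟩⟩
  loopless := ⟨fun u h => h.1.ne rfl⟩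

open Classical in
lemma card_commonNeighbors_lightGraph_le {V : Type} [Fintype V] {H : SimpleGraph V}
    {π : Sym2 V → ℕ} {B : Finset (Sym2 (Sym2 V))} (hinj : Set.InjOn π H.edgeSet)
    (hB : IsDoubleBlockingSet H π 3 B) (m : ℕ) {u w : V} (huw : u ≠ w) :
    (Finset.univ.filter fun x => (lightGraph H B m).Adj u x ∧ (lightGraph H B m).Adj w x).card
      ≤ 2 * m + 1 := by
  set X := Finset.univ.filter fun x => (lightGraph H B m).Adj u x ∧ (lightGraph H B m).Adj w x
    with hX
  rcases X.eq_empty_or_nonempty with h | ⟨x, hx⟩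
  · simp [h]
  have hx' := (Finset.mem_filter.1 hx).2
  have hsub : X ⊆ insert x (blockedVertices B s(u, x) ∪ blockedVertices B s(w, x)) := by
    intro y hy
    have hy' := (Finset.mem_filter.1 hy).2
    by_cases hxy : x = y
    · simp [hxy]
    · have := commonNeighbors_blocked hinj hB huw hxy hx'.1.1 hx'.2.1 hy'.1.1 hy'.2.1
      simp [this]
  have h1 := Finset.card_le_card hsub
  have h2 := Finset.card_insert_le x (blockedVertices B s(u, x) ∪ blockedVertices B s(w, x))
  have h3 := Finset.card_union_le (blockedVertices B s(u, x)) (blockedVertices B s(w, x))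
  have h4 := hx'.1.2
  have h5 := hx'.2.2
  omega

open Classical in
/-- At most eight quadruples of vertices span a given pair of `B`. -/
lemma card_quadruples_le {V : Type} [Fintype V] (B : Finset (Sym2 (Sym2 V))) :
    (Finset.univ.filter fun q : (V × V) × (V × V) =>
      s(s(q.1.1, q.1.2), s(q.2.1, q.2.2)) ∈ B).card ≤ 8 * B.card := by
  refine Finset.card_le_mul_card_image_of_maps_to
    (f := fun q : (V × V) × (V × V) => s(s(q.1.1, q.1.2), s(q.2.1, q.2.2)))
    (fun q hq => (Finset.mem_filter.1 hq).2) 8 ?_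
  intro β _
  induction β using Sym2.ind with | _ e e' =>
  induction e using Sym2.ind with | _ a b =>
  induction e' using Sym2.ind with | _ c d =>
  refine (Finset.card_le_card (t := ([((a, b), (c, d)), ((a, b), (d, c)), ((b, a), (c, d)),
    ((b, a), (d, c)), ((c, d), (a, b)), ((c, d), (b, a)), ((d, c), (a, b)),
    ((d, c), (b, a))] : List ((V × V) × (V × V))).toFinset) ?_).trans (List.toFinset_card_le _)
  rintro ⟨⟨p, q⟩, ⟨r, t⟩⟩ h
  have h := (Finset.mem_filter.1 h).2
  simp only [Sym2.eq_iff] at h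
  rcases h with ⟨⟨rfl, rfl⟩ | ⟨rfl, rfl⟩, ⟨rfl, rfl⟩ | ⟨rfl, rfl⟩⟩ |
    ⟨⟨rfl, rfl⟩ | ⟨rfl, rfl⟩, ⟨rfl, rfl⟩ | ⟨rfl, rfl⟩⟩ <;> simp

/-- In a finite set ordered by an injective rank, at most `t` elements have fewer than `t`
predecessors. -/
lemma card_filter_few_predecessors_le {α : Type*} [DecidableEq α] (S : Finset α) (r : α → ℕ)
    (hr : Set.InjOn r S) (t : ℕ) :
    (S.filter fun c => (S.filter fun a => r a < r c).card < t).card ≤ t := by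
  have hlt : ∀ x ∈ S, ∀ y, r x < r y →
      (S.filter fun a => r a < r x).card < (S.filter fun a => r a < r y).card := by
    intro x hx y hxy
    refine Finset.card_lt_card (Finset.ssubset_iff_of_subset ?_ |>.2 ⟨x, ?_, ?_⟩)
    · intro a ha
      simp only [Finset.mem_filter] at ha ⊢
      exact ⟨ha.1, ha.2.trans hxy⟩
    · simp [hx, hxy]
    · simp
  calc _ ≤ (Finset.range t).card := by
        refine Finset.card_le_card_of_injOn (fun c => (S.filter fun a => r a < r c).card) ?_ ?_
        · intro c hc
          simpa using (Finset.mem_filter.1 hc).2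
        · intro x hx y hy hxy
          have hx := (Finset.mem_filter.1 hx).1
          have hy := (Finset.mem_filter.1 hy).1
          refine hr hx hy ?_
          by_contra hne
          rcases lt_or_gt_of_ne hne with h | h
          · exact (hlt x hx y h).ne hxy
          · exact (hlt y hy x h).ne' hxy
    _ = t := Finset.card_range t

open Classical in
/-- The middle-heavy, chain-unblocked 3-paths of the light subgraph. -/
noncomputable def heavyPaths {V : Type} [Fintype V] (H : SimpleGraph V) (π : Sym2 V → ℕ)
    (B : Finset (Sym2 (Sym2 V))) (m : ℕ) : Finset ((V × V) × (V × V)) :=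
  Finset.univ.filter fun p =>
    (lightGraph H B m).Adj p.1.1 p.2.1 ∧ (lightGraph H B m).Adj p.2.1 p.2.2 ∧
    (lightGraph H B m).Adj p.2.2 p.1.2 ∧ p.1.1 ≠ p.1.2 ∧
    π s(p.1.1, p.2.1) < π s(p.2.1, p.2.2) ∧ π s(p.2.2, p.1.2) < π s(p.2.1, p.2.2) ∧
    p.1.1 ∉ blockedVertices B s(p.2.1, p.2.2) ∧ p.1.2 ∉ blockedVertices B s(p.2.1, p.2.2)

/-- The middle edges of two distinct heavy paths with the same endpoints are disjoint and form a
pair of `B`. -/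
lemma heavyPaths_meet {V : Type} [Fintype V] {H : SimpleGraph V} {π : Sym2 V → ℕ}
    {B : Finset (Sym2 (Sym2 V))} (hinj : Set.InjOn π H.edgeSet)
    (hB : IsDoubleBlockingSet H π 3 B) {m : ℕ} {a d b c b' c' : V}
    (hp : ((a, d), (b, c)) ∈ heavyPaths H π B m) (hq : ((a, d), (b', c')) ∈ heavyPaths H π B m)
    (hne : (b, c) ≠ (b', c')) :
    b ≠ b' ∧ c ≠ c' ∧ s(s(b, c), s(b', c')) ∈ B := by
  wlog hle : π s(b', c') ≤ π s(b, c) generalizing b c b' c'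
  · obtain ⟨h1, h2, h3⟩ := this hq hp hne.symm (le_of_not_ge hle)
    exact ⟨h1.symm, h2.symm, by rwa [Sym2.eq_swap]⟩
  simp only [heavyPaths, Finset.mem_filter, Finset.mem_univ, true_and] at hp hq
  obtain ⟨⟨hab, -⟩, ⟨hbc, -⟩, ⟨hcd, -⟩, had, l1, l2, na, nd⟩ := hp
  obtain ⟨⟨hab', -⟩, ⟨hbc', -⟩, ⟨hcd', -⟩, -, l1', l2', na', nd'⟩ := hq
  have hac : a ≠ c := by
    rintro rfl
    rw [Sym2.eq_swap] at l1
    exact lt_irrefl _ l1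
  have hbd : b ≠ d := by
    rintro rfl
    rw [Sym2.eq_swap] at l2
    exact lt_irrefl _ l2
  have hac' : a ≠ c' := by
    rintro rfl
    rw [Sym2.eq_swap] at l1'
    exact lt_irrefl _ l1'
  have hbd' : b' ≠ d := by
    rintro rfl
    rw [Sym2.eq_swap] at l2'
    exact lt_irrefl _ l2'
  have sw (x y : V) : s(x, y) = s(y, x) := Sym2.eq_swap
  have na1 (x : V) : s(s(b, c), s(a, x)) ∉ B :=
    fun h => na (mem_blockedVertices.2 ⟨_, h, by simp⟩)
  have nd1 (x : V) : s(s(b, c), s(d, x)) ∉ B :=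
    fun h => nd (mem_blockedVertices.2 ⟨_, h, by simp⟩)
  have hbc'' : b ≠ c' := by
    rintro rfl
    refine nd (triangle_apex_mem_blockedVertices hinj hB hbc hcd hcd'.symm l2.le ?_)
    rw [sw d b]
    exact l2'.le.trans hle
  have hcb'' : c ≠ b' := by
    rintro rfl
    refine na ?_
    rw [sw b c]
    refine triangle_apex_mem_blockedVertices hinj hB hbc.symm hab.symm hab' ?_ ?_
    · rw [sw b a, sw c b]
      exact l1.le
    · rw [sw c b]
      exact l1'.le.trans hle
  have hbb : b ≠ b' := by
    rintro rfl
    have hcc : c ≠ c' := fun h => hne (by rw [h])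
    have := fourCycle_blocked hinj hB hbc hcd hcd'.symm hbc'.symm hbd hcc l2.le
      (by rw [sw d c']; exact l2'.le.trans hle) (by rw [sw c' b]; exact hle)
    rw [sw c d] at this
    have h1 := nd1 c
    have h2 := nd1 c'
    tauto
  have hcc : c ≠ c' := by
    rintro rfl
    have := fourCycle_blocked hinj hB hbc.symm hab.symm hab' hbc' hac.symm hbb
      (by rw [sw b a, sw c b]; exact l1.le) (by rw [sw c b]; exact l1'.le.trans hle)
      (by rw [sw c b]; exact hle)
    rw [sw c b, sw b a] at this
    have h1 := na1 b
    have h2 := na1 b'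
    tauto
  refine ⟨hbb, hcc, ?_⟩
  rw [sw b' c']
  refine sixCycle_blocked hinj hB hab hbc hcd hcd'.symm hbc'.symm hab'.symm ?_ l1.le l2.le ?_ ?_ ?_
    na nd
  · have := hab.ne
    have := hab'.ne
    have := hbc.ne
    have := hbc'.ne
    have := hcd.ne
    have := hcd'.ne
    simp only [List.nodup_cons, List.mem_cons, List.not_mem_nil, or_false, not_or]
    grind
  · rw [sw d c']
    exact l2'.le.trans hle
  · rw [sw c' b']
    exact hle
  · rw [sw b' a]
    exact l1'.le.trans hle

open Classical in
/-- Meets of heavy paths are charged to pairs of `B`. -/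
lemma card_meets_le {V : Type} [Fintype V] {H : SimpleGraph V} {π : Sym2 V → ℕ}
    {B : Finset (Sym2 (Sym2 V))} (hinj : Set.InjOn π H.edgeSet)
    (hB : IsDoubleBlockingSet H π 3 B) (m : ℕ) :
    (((heavyPaths H π B m) ×ˢ (heavyPaths H π B m)).filter fun z =>
      z.1.1 = z.2.1 ∧ z.1 ≠ z.2).card ≤ (2 * m + 1) ^ 2 * (8 * B.card) := by
  refine le_trans ?_ (Nat.mul_le_mul_left _ (card_quadruples_le B))
  refine Finset.card_le_mul_card_image_of_maps_to (f := fun z => (z.1.2, z.2.2)) ?_ _ ?_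
  · rintro ⟨⟨⟨a, d⟩, b, c⟩, ⟨⟨a', d'⟩, b', c'⟩⟩ hz
    simp only [Finset.mem_filter, Finset.mem_product] at hz
    obtain ⟨⟨hp, hq⟩, h1, h2⟩ := hz
    obtain ⟨rfl, rfl⟩ := Prod.mk.inj h1
    exact Finset.mem_filter.2 ⟨Finset.mem_univ _,
      (heavyPaths_meet hinj hB hp hq (fun h => h2 (by rw [h]))).2.2⟩
  · rintro ⟨⟨b, c⟩, ⟨b', c'⟩⟩ -
    by_cases hdis : b ≠ b' ∧ c ≠ c'
    · let N (u w : V) := Finset.univ.filter fun x =>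
        (lightGraph H B m).Adj u x ∧ (lightGraph H B m).Adj w x
      calc _ ≤ (N b b' ×ˢ N c c').card := by
            refine Finset.card_le_card_of_injOn (fun z => z.1.1) ?_ ?_
            · rintro ⟨⟨⟨a, d⟩, b, c⟩, ⟨⟨a', d'⟩, b', c'⟩⟩ hz
              simp only [Finset.coe_filter, Finset.mem_filter, Finset.mem_product,
                Set.mem_ofPred_eq, Prod.mk.injEq] at hz
              obtain ⟨⟨⟨hp, hq⟩, ⟨rfl, rfl⟩, -⟩, ⟨rfl, rfl⟩, rfl, rfl⟩ := hz
              simp only [heavyPaths, Finset.mem_filter, Finset.mem_univ, true_and] at hp hq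
              simp [N, hp.1.symm, hq.1.symm, hp.2.2.1, hq.2.2.1]
            · rintro ⟨⟨⟨a, d⟩, b, c⟩, ⟨⟨a', d'⟩, b', c'⟩⟩ hz
                ⟨⟨⟨x, y⟩, p, q⟩, ⟨⟨x', y'⟩, p', q'⟩⟩ hw h
              simp only [Finset.coe_filter, Finset.mem_filter, Finset.mem_product,
                Set.mem_ofPred_eq, Prod.mk.injEq] at hz hw h ⊢
              grind
        _ ≤ _ := by
            rw [Finset.card_product, sq]
            exact Nat.mul_le_mul (card_commonNeighbors_lightGraph_le hinj hB m hdis.1)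
              (card_commonNeighbors_lightGraph_le hinj hB m hdis.2)
    · rw [Finset.card_eq_zero.2]
      · exact Nat.zero_le _
      · refine Finset.filter_eq_empty_iff.2 ?_
        rintro ⟨⟨⟨a, d⟩, p, q⟩, ⟨⟨a', d'⟩, p', q'⟩⟩ hz hf
        simp only [Finset.mem_filter, Finset.mem_product] at hz
        simp only [Prod.mk.injEq] at hf
        obtain ⟨⟨hp, hq⟩, h1, h2⟩ := hz
        obtain ⟨⟨rfl, rfl⟩, rfl, rfl⟩ := hf
        obtain ⟨rfl, rfl⟩ := Prod.mk.inj h1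
        have := heavyPaths_meet hinj hB hp hq (fun h => h2 (by rw [h]))
        exact hdis ⟨this.1, this.2.1⟩

/-- Cauchy–Schwarz for collisions of a map. -/
lemma card_sq_le_card_mul_card_collisions {α β : Type*} [DecidableEq α] [Fintype β]
    [DecidableEq β] (S : Finset α) (g : α → β) :
    S.card ^ 2 ≤ Fintype.card β *
      (S.card + ((S ×ˢ S).filter fun z => g z.1 = g z.2 ∧ z.1 ≠ z.2).card) := by
  have h1 : S.card = ∑ y : β, (S.filter fun x => g x = y).card :=
    Finset.card_eq_sum_card_fiberwise (fun _ _ => Finset.mem_univ _)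
  have h2 : ∑ y : β, (S.filter fun x => g x = y).card ^ 2
      = ((S ×ˢ S).filter fun z => g z.1 = g z.2).card := by
    rw [Finset.card_eq_sum_card_fiberwise (f := fun z => g z.1) (t := Finset.univ)
      (fun _ _ => Finset.mem_univ _)]
    refine Finset.sum_congr rfl fun y _ => ?_
    rw [sq, ← Finset.card_product]
    congr 1
    ext ⟨p, q⟩
    simp only [Finset.mem_product, Finset.mem_filter]
    grind
  have h3 : ((S ×ˢ S).filter fun z => g z.1 = g z.2).card ≤
      S.card + ((S ×ˢ S).filter fun z => g z.1 = g z.2 ∧ z.1 ≠ z.2).card := by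
    rw [← Finset.diag_card S]
    refine (Finset.card_le_card ?_).trans (Finset.card_union_le _ _)
    rintro ⟨p, q⟩ h
    simp only [Finset.mem_union, Finset.mem_filter, Finset.mem_product, Finset.mem_diag] at h ⊢
    grind
  calc S.card ^ 2 = (∑ y : β, (S.filter fun x => g x = y).card) ^ 2 := by rw [← h1]
    _ ≤ Fintype.card β * ∑ y : β, (S.filter fun x => g x = y).card ^ 2 := by
        simpa using sq_sum_le_card_mul_sum_sq (s := (Finset.univ : Finset β))
          (f := fun y => (S.filter fun x => g x = y).card)
    _ ≤ _ := by
        rw [h2]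
        exact Nat.mul_le_mul_left _ h3

lemma card_filter_prod {V : Type} [Fintype V] (P : V → V → Prop) [∀ u v, Decidable (P u v)] :
    (Finset.univ.filter fun p : V × V => P p.1 p.2).card
      = ∑ u, (Finset.univ.filter fun v => P u v).card := by
  simp only [Finset.card_filter, Fintype.sum_prod_type]

open Classical in
/-- The ordered edges of the light subgraph preceded by at least `t` light edges at both ends. -/
noncomputable def richDarts {V : Type} [Fintype V] (H : SimpleGraph V) (π : Sym2 V → ℕ)
    (B : Finset (Sym2 (Sym2 V))) (m t : ℕ) : Finset (V × V) :=
  Finset.univ.filter fun p =>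
    (lightGraph H B m).Adj p.1 p.2 ∧
    t ≤ (Finset.univ.filter fun a =>
      (lightGraph H B m).Adj p.1 a ∧ π s(p.1, a) < π s(p.1, p.2)).card ∧
    t ≤ (Finset.univ.filter fun d =>
      (lightGraph H B m).Adj p.2 d ∧ π s(p.2, d) < π s(p.2, p.1)).card

open Classical in
lemma card_richDarts_mul_le {V : Type} [Fintype V] (H : SimpleGraph V) (π : Sym2 V → ℕ)
    (B : Finset (Sym2 (Sym2 V))) (m s : ℕ) :
    (richDarts H π B m (m + s + 1)).card * s ^ 2 ≤ (heavyPaths H π B m).card := by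
  have hfib : ∀ p ∈ richDarts H π B m (m + s + 1),
      s ^ 2 ≤ ((heavyPaths H π B m).filter fun x => x.2 = p).card := by
    rintro ⟨b, c⟩ hp
    simp only [richDarts, Finset.mem_filter, Finset.mem_univ, true_and] at hp
    obtain ⟨hbc, hX, hY⟩ := hp
    set X := Finset.univ.filter fun a =>
      (lightGraph H B m).Adj b a ∧ π s(b, a) < π s(b, c) with hXdef
    set Y := Finset.univ.filter fun d =>
      (lightGraph H B m).Adj c d ∧ π s(c, d) < π s(c, b) with hYdef
    set T := blockedVertices B s(b, c) with hT
    have hTc : T.card ≤ m := hbc.2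
    have hX1 : s ≤ (X \ T).card := by
      have := Finset.le_card_sdiff T X
      omega
    have hY1 (a : V) : s ≤ ((Y \ T).erase a).card := by
      have := Finset.le_card_sdiff T Y
      have := Finset.pred_card_le_card_erase (s := Y \ T) (a := a)
      omega
    calc s ^ 2 ≤ (X \ T).card * s := by
          rw [sq]
          exact Nat.mul_le_mul_right _ hX1
      _ ≤ ∑ a ∈ X \ T, ((Y \ T).erase a).card := by
          simpa using Finset.card_nsmul_le_sum (X \ T) _ s fun a _ => hY1 a
      _ = ((X \ T).sigma fun a => (Y \ T).erase a).card := (Finset.card_sigma _ _).symm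
      _ ≤ _ := by
          refine Finset.card_le_card_of_injOn (fun x => ((x.1, x.2), (b, c))) ?_ ?_
          · rintro ⟨a, d⟩ h
            simp only [Finset.coe_sigma, Set.mem_sigma_iff, Finset.mem_coe, Finset.mem_sdiff,
              Finset.mem_erase, hXdef, hYdef, Finset.mem_filter, Finset.mem_univ, true_and] at h
            obtain ⟨⟨⟨h1, h2⟩, h3⟩, h4, ⟨h5, h6⟩, h7⟩ := h
            rw [Sym2.eq_swap (a := c) (b := b)] at h6
            rw [Sym2.eq_swap (a := b) (b := a)] at h2
            simp only [Finset.mem_coe, heavyPaths, Finset.mem_filter, Finset.mem_univ, true_and,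
              and_true]
            exact ⟨h1.symm, hbc, h5, h4.symm, h2, h6, h3, h7⟩
          · rintro ⟨a, d⟩ - ⟨a', d'⟩ - h
            simp only [Prod.mk.injEq, and_true] at h
            obtain ⟨rfl, rfl⟩ := h
            rfl
  calc _ ≤ ∑ p ∈ richDarts H π B m (m + s + 1),
        ((heavyPaths H π B m).filter fun x => x.2 = p).card := by
        simpa using Finset.card_nsmul_le_sum _ _ _ hfib
    _ ≤ ∑ p : V × V, ((heavyPaths H π B m).filter fun x => x.2 = p).card :=
        Finset.sum_le_sum_of_subset (Finset.subset_univ _)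
    _ = _ := (Finset.card_eq_sum_card_fiberwise fun _ _ => Finset.mem_univ _).symm

open Classical in
lemma two_mul_card_edges_le {V : Type} [Fintype V] {H : SimpleGraph V} {π : Sym2 V → ℕ}
    {B : Finset (Sym2 (Sym2 V))} (hinj : Set.InjOn π H.edgeSet) (m t : ℕ) :
    ∃ h : ℕ, h * (m + 1) ≤ 8 * B.card ∧
      2 * H.edgeSet.ncard ≤ (richDarts H π B m t).card + 2 * (Fintype.card V * t) + h := by
  set D := Finset.univ.filter fun p : V × V => H.Adj p.1 p.2 with hD
  set L := Finset.univ.filter fun p : V × V =>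
    H.Adj p.1 p.2 ∧ m + 1 ≤ (blockedVertices B s(p.1, p.2)).card with hL
  set P := Finset.univ.filter fun p : V × V => (lightGraph H B m).Adj p.1 p.2 ∧
    (Finset.univ.filter fun a =>
      (lightGraph H B m).Adj p.1 a ∧ π s(p.1, a) < π s(p.1, p.2)).card < t with hP
  set P' := Finset.univ.filter fun p : V × V => (lightGraph H B m).Adj p.1 p.2 ∧
    (Finset.univ.filter fun a =>
      (lightGraph H B m).Adj p.2 a ∧ π s(p.2, a) < π s(p.2, p.1)).card < t with hP'
  have hDcard : D.card = 2 * H.edgeSet.ncard := by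
    rw [hD, card_filter_prod H.Adj, Set.ncard_eq_toFinset_card', ← SimpleGraph.edgeFinset,
      ← SimpleGraph.sum_degrees_eq_twice_card_edges]
    refine Finset.sum_congr rfl fun u _ => ?_
    rw [← SimpleGraph.card_neighborFinset_eq_degree, SimpleGraph.neighborFinset_eq_filter]
  have hPcard : P.card ≤ Fintype.card V * t := by
    rw [hP, card_filter_prod fun b c => (lightGraph H B m).Adj b c ∧
      (Finset.univ.filter fun a =>
        (lightGraph H B m).Adj b a ∧ π s(b, a) < π s(b, c)).card < t]
    refine (Finset.sum_le_card_nsmul _ _ t fun b _ => ?_).trans (by simp)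
    have := card_filter_few_predecessors_le
      (Finset.univ.filter fun a => (lightGraph H B m).Adj b a) (fun a => π s(b, a)) ?_ t
    · simpa only [Finset.filter_filter] using this
    · intro x hx y hy hxy
      have hx := (Finset.mem_filter.1 hx).2.1
      have hy := (Finset.mem_filter.1 hy).2.1
      exact Sym2.congr_right.1 (hinj (H.mem_edgeSet.2 hx) (H.mem_edgeSet.2 hy) hxy)
  have hPcard' : P'.card ≤ P.card := by
    refine Finset.card_le_card_of_injOn Prod.swap ?_ Prod.swap_injective.injOn
    rintro ⟨b, c⟩ h
    simp only [hP', hP, Finset.mem_coe, Finset.mem_filter, Finset.mem_univ, true_and,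
      Prod.fst_swap, Prod.snd_swap] at h ⊢
    exact ⟨h.1.symm, h.2⟩
  have hsub : D ⊆ richDarts H π B m t ∪ (P ∪ P') ∪ L := by
    rintro ⟨b, c⟩ h
    simp only [hD, hP, hP', hL, richDarts, Finset.mem_union, Finset.mem_filter, Finset.mem_univ,
      true_and] at h ⊢
    by_cases hl : m + 1 ≤ (blockedVertices B s(b, c)).card
    · exact Or.inr ⟨h, hl⟩
    · have hA : (lightGraph H B m).Adj b c := ⟨h, by omega⟩
      simp only [hA, true_and]
      omega
  refine ⟨L.card, ?_, ?_⟩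
  · refine le_trans ?_ (card_quadruples_le B)
    calc L.card * (m + 1) ≤ ∑ p ∈ L, (blockedVertices B s(p.1, p.2)).card := by
          simpa using Finset.card_nsmul_le_sum L _ (m + 1) fun p hp => (Finset.mem_filter.1 hp).2.2
      _ = (L.sigma fun p => blockedVertices B s(p.1, p.2)).card := (Finset.card_sigma _ _).symm
      _ ≤ _ := by
          have hw : ∀ (p : V × V) (z : V), z ∈ blockedVertices B s(p.1, p.2) →
              ∃ y, s(s(p.1, p.2), s(z, y)) ∈ B := by
            intro p z hz
            obtain ⟨e', he', y, rfl⟩ := mem_blockedVertices.1 hz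
            exact ⟨y, he'⟩
          choose! g hg using hw
          refine Finset.card_le_card_of_injOn (fun x => (x.1, (x.2, g x.1 x.2))) ?_ ?_
          · rintro ⟨p, z⟩ h
            have h := (Finset.mem_sigma.1 h).2
            exact Finset.mem_coe.2 (Finset.mem_filter.2 ⟨Finset.mem_univ _, hg p z h⟩)
          · rintro ⟨p, z⟩ - ⟨q, y⟩ - h
            simp only [Prod.mk.injEq] at h
            obtain ⟨rfl, rfl, -⟩ := h
            rfl
  · have h1 := Finset.card_le_card hsub
    have h2 := Finset.card_union_le (richDarts H π B m t ∪ (P ∪ P')) L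
    have h3 := Finset.card_union_le (richDarts H π B m t) (P ∪ P')
    have h4 := Finset.card_union_le P P'
    omega

/-- The numerical conclusion from the bounds on the number of paths `N` and meets `M`. -/
lemma edge_bound_of_path_bounds {n f E N M : ℝ} (hn : 0 ≤ n) (hf : 0 ≤ f) (hE : 0 ≤ E)
    (hN : 0 ≤ N) (h1 : E ^ 3 ≤ 256 * n ^ 2 * N) (h2 : N ^ 2 ≤ n ^ 2 * (N + M))
    (h3 : M ≤ 8712 * f ^ 3 * E) :
    E ≤ 8 * n ^ ((4 : ℝ) / 3) ∨ E ≤ 70 * (n ^ ((6 : ℝ) / 5) * f ^ ((3 : ℝ) / 5)) := by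
  have e1 : (n ^ ((4 : ℝ) / 3)) ^ 3 = n ^ 4 := by
    rw [← Real.rpow_natCast, ← Real.rpow_mul hn, ← Real.rpow_natCast]
    norm_num
  have e2 : (n ^ ((6 : ℝ) / 5)) ^ 5 = n ^ 6 := by
    rw [← Real.rpow_natCast, ← Real.rpow_mul hn, ← Real.rpow_natCast]
    norm_num
  have e3 : (f ^ ((3 : ℝ) / 5)) ^ 5 = f ^ 3 := by
    rw [← Real.rpow_natCast, ← Real.rpow_mul hf, ← Real.rpow_natCast]
    norm_num
  rcases le_total N (2 * n ^ 2) with h | h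
  · left
    refine le_of_pow_le_pow_left₀ (n := 3) (by norm_num) (by positivity) ?_
    rw [mul_pow, e1]
    calc E ^ 3 ≤ 256 * n ^ 2 * N := h1
      _ ≤ 256 * n ^ 2 * (2 * n ^ 2) := by gcongr
      _ = 8 ^ 3 * n ^ 4 := by ring
  · right
    rcases hE.eq_or_lt with h0 | hE0
    · rw [← h0]
      positivity
    refine le_of_pow_le_pow_left₀ (n := 5) (by norm_num) (by positivity) ?_
    rw [mul_pow, mul_pow, e2, e3]
    have h4 : N ^ 2 ≤ 2 * n ^ 2 * M := by nlinarith
    have h5 : E ^ 6 ≤ 2 ^ 17 * 8712 * n ^ 6 * f ^ 3 * E := by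
      calc E ^ 6 = (E ^ 3) ^ 2 := by ring
        _ ≤ (256 * n ^ 2 * N) ^ 2 := by gcongr
        _ = 2 ^ 16 * n ^ 4 * N ^ 2 := by ring
        _ ≤ 2 ^ 16 * n ^ 4 * (2 * n ^ 2 * (8712 * f ^ 3 * E)) := by
            gcongr
            exact h4.trans (by gcongr)
        _ = _ := by ring
    have h6 : E ^ 5 ≤ 2 ^ 17 * 8712 * n ^ 6 * f ^ 3 := by
      refine le_of_mul_le_mul_right ?_ hE0
      calc E ^ 5 * E = E ^ 6 := by ring
        _ ≤ _ := h5
    have h7 : 0 ≤ n ^ 6 * f ^ 3 := by positivity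
    linarith

open Classical in
/-- Either the graph is sparse, or it has many heavy paths. -/
lemma sparse_or_many_heavyPaths {V : Type} [Fintype V] {H : SimpleGraph V} {π : Sym2 V → ℕ}
    {B : Finset (Sym2 (Sym2 V))} {f : ℕ} (hf : 0 < f) (hinj : Set.InjOn π H.edgeSet)
    (hcard : B.card ≤ f * H.edgeSet.ncard) :
    H.edgeSet.ncard ≤ 140 * (f * Fintype.card V) ∨
      H.edgeSet.ncard ^ 3 ≤ 256 * Fintype.card V ^ 2 * (heavyPaths H π B (16 * f)).card := by
  set E := H.edgeSet.ncard with hE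
  set n := Fintype.card V with hn
  rcases Nat.eq_zero_or_pos n with h0 | hpos
  · have : IsEmpty V := Fintype.card_eq_zero_iff.1 h0
    left
    have : H.edgeSet = ∅ := by
      refine Set.eq_empty_of_forall_notMem fun e => ?_
      induction e using Sym2.ind with | _ a b => exact isEmptyElim a
    simp [hE, this]
  set t := E / (4 * n) with ht
  have ht1 : 4 * n * t ≤ E := Nat.mul_div_le _ _
  have ht2 : E < 4 * n * (t + 1) := Nat.lt_mul_div_succ E (by omega)
  rcases le_or_gt t (34 * f) with hle | hgt
  · left
    calc E ≤ 4 * n * (t + 1) := ht2.le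
      _ ≤ 4 * n * (35 * f) := Nat.mul_le_mul_left _ (by omega)
      _ = 140 * (f * n) := by ring
  · right
    obtain ⟨s, hs⟩ : ∃ s, t = 16 * f + s + 1 := ⟨t - 16 * f - 1, by omega⟩
    obtain ⟨h, hh, hG⟩ := two_mul_card_edges_le (B := B) hinj (16 * f) t
    rw [← hE, ← hn] at hG
    have hP := card_richDarts_mul_le H π B (16 * f) s
    rw [← hs] at hP
    have hh2 : 2 * h ≤ E := by
      have : h * (16 * f) ≤ 8 * (f * E) := by nlinarith
      nlinarith
    have hGE : E ≤ (richDarts H π B (16 * f) t).card := by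
      have : 4 * (n * t) ≤ E := by linarith
      omega
    have hEt : E ≤ 16 * n * s := by
      calc E ≤ 4 * n * (t + 1) := ht2.le
        _ ≤ 4 * n * (4 * s) := Nat.mul_le_mul_left _ (by omega)
        _ = 16 * n * s := by ring
    calc E ^ 3 = E ^ 2 * E := by ring
      _ ≤ (16 * n * s) ^ 2 * (richDarts H π B (16 * f) t).card := by gcongr
      _ = 256 * n ^ 2 * ((richDarts H π B (16 * f) t).card * s ^ 2) := by ring
      _ ≤ _ := by gcongr

/-- There is an absolute constant `C > 0` such that if `f` is a positive
integer and `H` is a graph on `n` vertices, equipped with a linear order on its edges,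
that admits a `6` double-blocking set of size at most `f·|E(H)|`, then
`|E(H)| ≤ C·(n^{4/3} + n^{6/5}·f^{3/5} + f·n)`. -/
theorem statement_7 :
    ∃ C : ℝ, 0 < C ∧
      ∀ (V : Type) [Fintype V], ∀ (H : SimpleGraph V) (π : Sym2 V → ℕ)
        (B : Finset (Sym2 (Sym2 V))) (f : ℕ),
        0 < f →
        Set.InjOn π H.edgeSet →
        IsDoubleBlockingSet H π 3 B →
        B.card ≤ f * H.edgeSet.ncard →
        (H.edgeSet.ncard : ℝ) ≤
          C * ((Fintype.card V : ℝ) ^ ((4 : ℝ) / 3)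
            + (Fintype.card V : ℝ) ^ ((6 : ℝ) / 5) * (f : ℝ) ^ ((3 : ℝ) / 5)
            + (f : ℝ) * (Fintype.card V : ℝ)) := by
  classical
  refine ⟨140, by norm_num, ?_⟩
  intro V _ H π B f hf hinj hB hcard
  have hx : 0 ≤ (Fintype.card V : ℝ) ^ ((4 : ℝ) / 3) := by positivity
  have hy : 0 ≤ (Fintype.card V : ℝ) ^ ((6 : ℝ) / 5) * (f : ℝ) ^ ((3 : ℝ) / 5) := by positivity
  have hz : 0 ≤ (f : ℝ) * (Fintype.card V : ℝ) := by positivity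
  rcases sparse_or_many_heavyPaths hf hinj hcard with h | h
  · have : (H.edgeSet.ncard : ℝ) ≤ 140 * (f * Fintype.card V) := by exact_mod_cast h
    linarith
  · have hCS := card_sq_le_card_mul_card_collisions (heavyPaths H π B (16 * f)) Prod.fst
    have hM := card_meets_le hinj hB (16 * f)
    set N := (heavyPaths H π B (16 * f)).card
    set M := (((heavyPaths H π B (16 * f)) ×ˢ (heavyPaths H π B (16 * f))).filter fun z =>
      z.1.1 = z.2.1 ∧ z.1 ≠ z.2).card
    rw [Fintype.card_prod, ← sq] at hCS
    have hM' : M ≤ 8712 * f ^ 3 * H.edgeSet.ncard := by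
      calc M ≤ (2 * (16 * f) + 1) ^ 2 * (8 * B.card) := hM
        _ ≤ (33 * f) ^ 2 * (8 * (f * H.edgeSet.ncard)) := by
            gcongr
            omega
        _ = _ := by ring
    rcases edge_bound_of_path_bounds (n := Fintype.card V) (f := f) (E := H.edgeSet.ncard)
      (N := N) (M := M) (by positivity) (by positivity) (by positivity) (by positivity)
      (by exact_mod_cast h) (by exact_mod_cast hCS) (by exact_mod_cast hM') with h | h
    · linarith
    · linarith
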